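/- Let V be a brace algebra. The coalgebra map ∪ on T(V[1]) defined by (x_1,...,x_m) ∪ (y_1,...,y_n) = Σ_{0≤i_1≤j_1≤...≤i_m≤j_m≤n} (-1)^ε (y_1,...,y_{i_1}, x_1{y_{i_1+1},...,y_{j_1}},...,x_m{y_{i_m+1},...,y_{j_m}},...,y_n), with ε = Σ_p |x_p|(Σ_{q≤i_p}|y_q|), is associative. Conversely, if this coalgebra map is associative then the braces satisfy the higher pre-Jacobi identities. -/

import Mathlib

/-!  A model of the tensor coalgebra `T(W)` of a graded vector space
`W = (V d)_{d ∈ ℤ}`:  `T = ⨁_{l : List ℤ} V l₁ ⊗ ⋯ ⊗ V lₙ`,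
with pure tensors (words) of homogeneous elements as spanning set. -/

open TensorProduct DirectSum

section TensorCoalgebraModel

variable (K : Type) [Field K] (V : ℤ → Type) [∀ d, AddCommGroup (V d)]
  [∀ d, Module K (V d)]

/-- The homogeneous component of the tensor coalgebra indexed by a list of
degrees, as an object of `ModuleCat K` (so that instances are bundled). -/
noncomputable def TpM : List ℤ → ModuleCat K
  | [] => ModuleCat.of K K
  | d :: l => ModuleCat.of K (V d ⊗[K] (TpM l))

/-- The underlying type of a homogeneous component. -/
abbrev Tp (l : List ℤ) : Type := (TpM K V l)

/-- The tensor coalgebra `T(W) = ⊕_n W^{⊗n}`, with components refined by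
lists of degrees. -/
abbrev TCo : Type := ⨁ l : List ℤ, Tp K V l

/-- The underlying graded vector space `W = ⊕_d V d`. -/
abbrev GrW : Type := ⨁ d : ℤ, V d

variable {K V}

/-- The pure tensor associated to a list of homogeneous elements. -/
noncomputable def tp : (l : List (Σ d : ℤ, V d)) → Tp K V (l.map Sigma.fst)
  | [] => (1 : K)
  | x :: l => (x.2 ⊗ₜ[K] tp l : V x.1 ⊗[K] Tp K V (l.map Sigma.fst))

/-- The word `(x_1, …, x_n)` of homogeneous elements, as an element of the
tensor coalgebra. -/
noncomputable def word (l : List (Σ d : ℤ, V d)) : TCo K V :=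
  DirectSum.lof K (List ℤ) (fun l => Tp K V l) (l.map Sigma.fst) (tp l)

/-- A homogeneous element, as an element of `W = ⊕_d V d`. -/
noncomputable def homog (x : Σ d : ℤ, V d) : GrW V := DirectSum.lof K ℤ V x.1 x.2

/-- Total degree of a word (sum of the degrees of the letters). -/
def degSum (l : List (Σ d : ℤ, V d)) : ℤ := (l.map Sigma.fst).sum

end TensorCoalgebraModel

section SigmaBrace

variable {K : Type} [Field K] {V : ℤ → Type} [∀ d, AddCommGroup (V d)]
  [∀ d, Module K (V d)]

/-- Nested-brace combinations of the higher pre-Jacobi identity, for braces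
on homogeneous elements, with sign exponents
`ε = Σ_p |x_p| (Σ_{q ≤ i_p} |y_q|)`. -/
def sigCombos (br : (Σ d : ℤ, V d) → List (Σ d : ℤ, V d) → (Σ d : ℤ, V d)) :
    List (Σ d : ℤ, V d) → ℤ → List (Σ d : ℤ, V d) →
      List (ℤ × List (Σ d : ℤ, V d))
  | [], _, ys => [(0, ys)]
  | x :: xs, acc, ys =>
    (List.range (ys.length + 1)).flatMap fun i =>
      (List.range (ys.length - i + 1)).flatMap fun k =>
        let pre := ys.take i
        let seg := (ys.drop i).take k
        let rest := ys.drop (i + k)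
        (sigCombos br xs (acc + degSum pre + degSum seg) rest).map
          fun p => (p.1 + x.1 * (acc + degSum pre), pre ++ br x seg :: p.2)

/-- The higher pre-Jacobi identities for a degree-zero brace structure on
homogeneous elements (values compared inside `W = ⊕_d V d`). -/
def SigmaPreJacobi
    (br : (Σ d : ℤ, V d) → List (Σ d : ℤ, V d) → (Σ d : ℤ, V d)) : Prop :=
  ∀ (x : Σ d : ℤ, V d) (xs ys : List (Σ d : ℤ, V d)),
    homog (K := K) (br (br x xs) ys) =
      ((sigCombos br xs 0 ys).map
        fun p => ((Int.negOnePow p.1 : ℤˣ) : ℤ) • homog (K := K) (br x p.2)).sum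

end SigmaBrace

section Degrees

variable {V : ℤ → Type} {br : (Σ d : ℤ, V d) → List (Σ d : ℤ, V d) → (Σ d : ℤ, V d)}

lemma degSum_nil : degSum ([] : List (Σ d : ℤ, V d)) = 0 := rfl

lemma degSum_cons (x : Σ d : ℤ, V d) (l : List (Σ d : ℤ, V d)) :
    degSum (x :: l) = x.1 + degSum l := by simp [degSum]

lemma degSum_append (l m : List (Σ d : ℤ, V d)) :
    degSum (l ++ m) = degSum l + degSum m := by simp [degSum]

lemma sigCombos_cons_cons (x y : Σ d : ℤ, V d) (xs ys : List (Σ d : ℤ, V d)) (acc : ℤ) :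
    sigCombos br (x :: xs) acc (y :: ys) =
      ((List.range (ys.length + 2)).flatMap fun k =>
        (sigCombos br xs (acc + degSum ((y :: ys).take k)) ((y :: ys).drop k)).map
          fun p => (p.1 + x.1 * acc, br x ((y :: ys).take k) :: p.2)) ++
      (sigCombos br (x :: xs) (acc + y.1) ys).map fun p => (p.1, y :: p.2) := by
  rw [sigCombos, sigCombos, List.length_cons]
  conv_lhs => rw [List.range_succ_eq_map, List.flatMap_cons]
  congr 1
  · simp [degSum_nil]
  · rw [List.flatMap_map, List.map_flatMap]
    refine List.flatMap_congr fun i _ => ?_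
    rw [List.map_flatMap, Nat.succ_eq_add_one, Nat.add_sub_add_right]
    refine List.flatMap_congr fun k _ => ?_
    rw [Nat.add_right_comm i 1 k]
    simp only [List.take_succ_cons, List.drop_succ_cons, degSum_cons, List.map_map,
      ← add_assoc, Function.comp_def, List.cons_append]

lemma sigCombos_cons_nil (x : Σ d : ℤ, V d) (xs : List (Σ d : ℤ, V d)) (acc : ℤ) :
    sigCombos br (x :: xs) acc [] =
      (sigCombos br xs acc []).map fun p => (p.1 + x.1 * acc, br x [] :: p.2) := by
  simp [sigCombos, degSum_nil]

lemma degSum_of_mem_sigCombos (hbr_deg : ∀ x l, (br x l).1 = x.1 + degSum l)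
    (xs ys : List (Σ d : ℤ, V d)) (acc : ℤ) :
    ∀ p ∈ sigCombos br xs acc ys, degSum p.2 = degSum xs + degSum ys := by
  induction xs generalizing ys acc with
  | nil => simp [sigCombos, degSum_nil]
  | cons x xs ih =>
    intro p hp
    simp only [sigCombos, List.mem_flatMap, List.mem_map] at hp
    obtain ⟨i, -, k, -, q, hq, rfl⟩ := hp
    have h1 := degSum_append (ys.take i) (ys.drop i)
    have h2 := degSum_append ((ys.drop i).take k) ((ys.drop i).drop k)
    rw [List.take_append_drop] at h1 h2
    rw [List.drop_drop] at h2
    simp only [degSum_append, degSum_cons, hbr_deg, ih _ _ q hq]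
    linarith

end Degrees

section Words

variable {K : Type} [Field K] {V : ℤ → Type} [∀ d, AddCommGroup (V d)]
  [∀ d, Module K (V d)]

variable (K V) in
/-- Concatenation of a letter in front of a tensor, `W ⊗ T(W) → T(W)`, in curried form. -/
noncomputable def consMap : GrW V →ₗ[K] TCo K V →ₗ[K] TCo K V :=
  DirectSum.toModule K ℤ _ fun d =>
    LinearMap.flip <| DirectSum.toModule K (List ℤ) _ fun l =>
      LinearMap.flip <|
        (TensorProduct.mk K (V d) (Tp K V l)).compr₂
          (DirectSum.lof K (List ℤ) (fun l => Tp K V l) (d :: l) :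
            (V d ⊗[K] Tp K V l) →ₗ[K] TCo K V)

lemma consMap_homog_lof (x : Σ d : ℤ, V d) (l : List ℤ) (t : Tp K V l) :
    consMap K V (homog (K := K) x) (DirectSum.lof K (List ℤ) (fun l => Tp K V l) l t) =
      DirectSum.lof K (List ℤ) (fun l => Tp K V l) (x.1 :: l)
        (x.2 ⊗ₜ[K] t : V x.1 ⊗[K] Tp K V l) := by
  unfold consMap homog
  rw [DirectSum.toModule_lof, LinearMap.flip_apply, DirectSum.toModule_lof]
  rfl

lemma consMap_homog_word (x : Σ d : ℤ, V d) (l : List (Σ d : ℤ, V d)) :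
    consMap K V (homog (K := K) x) (word l) = word (x :: l) :=
  consMap_homog_lof x _ _

lemma lof_mem_span_word (l : List ℤ) (t : Tp K V l) :
    DirectSum.lof K (List ℤ) (fun l => Tp K V l) l t ∈
      Submodule.span K (Set.range (word : List (Σ d : ℤ, V d) → TCo K V)) := by
  induction l with
  | nil =>
    have h : t = (show K from t) • (show Tp K V [] from (1 : K)) :=
      (mul_one (show K from t)).symm
    rw [h, map_smul]
    exact Submodule.smul_mem _ _ (Submodule.subset_span ⟨[], rfl⟩)
  | cons d l ih =>
    induction t using TensorProduct.induction_on (R := K) (M := V d) (N := Tp K V l) with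
    | zero => exact (map_zero (DirectSum.lof K (List ℤ) (fun l => Tp K V l) (d :: l))).symm ▸
        Submodule.zero_mem _
    | tmul v t =>
      rw [← consMap_homog_lof ⟨d, v⟩ l t]
      have h := Submodule.mem_map_of_mem (f := consMap K V (homog (K := K) ⟨d, v⟩)) (ih t)
      rw [Submodule.map_span] at h
      refine Submodule.span_mono ?_ h
      rintro _ ⟨_, ⟨w, rfl⟩, rfl⟩
      exact ⟨⟨d, v⟩ :: w, (consMap_homog_word _ _).symm⟩
    | add a b ha hb =>
      have h := map_add (DirectSum.lof K (List ℤ) (fun l => Tp K V l) (d :: l)) a b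
      exact h.symm ▸ Submodule.add_mem _ ha hb

lemma TCo.linearMap_ext {M : Type*} [AddCommGroup M] [Module K M] {g h : TCo K V →ₗ[K] M}
    (H : ∀ l, g (word l) = h (word l)) : g = h := by
  refine DirectSum.linearMap_ext K fun l => LinearMap.ext fun t => ?_
  have hw : Set.EqOn g h (Set.range (word : List (Σ d : ℤ, V d) → TCo K V)) := by
    rintro _ ⟨w, rfl⟩
    exact H w
  exact LinearMap.eqOn_span hw (lof_mem_span_word l t)

variable (K) in
/-- The sign `(-1)^n` in `K`. -/
def sgn (n : ℤ) : K := (((Int.negOnePow n : ℤˣ) : ℤ) : K)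

lemma sgn_smul {M : Type*} [AddCommGroup M] [Module K M] (n : ℤ) (m : M) :
    ((Int.negOnePow n : ℤˣ) : ℤ) • m = sgn K n • m :=
  (Int.cast_smul_eq_zsmul K _ m).symm

lemma sgn_add (m n : ℤ) : sgn K (m + n) = sgn K m * sgn K n := by
  simp [sgn, Int.negOnePow_add]

lemma sgn_zero : sgn K 0 = 1 := by simp [sgn]

variable (K V) in
/-- The Koszul sign operator: multiplication by `(-1)^{m |t|}` on elements `t` of degree `|t|`. -/
noncomputable def koszul (m : ℤ) : TCo K V →ₗ[K] TCo K V :=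
  DirectSum.toModule K (List ℤ) _ fun l =>
    sgn K (m * l.sum) • DirectSum.lof K (List ℤ) (fun l => Tp K V l) l

lemma koszul_word (m : ℤ) (l : List (Σ d : ℤ, V d)) :
    koszul K V m (word l) = sgn K (m * degSum l) • word l := by
  unfold koszul word
  rw [DirectSum.toModule_lof]
  rfl

end Words

section Combos

variable {K : Type} [Field K] {V : ℤ → Type} [∀ d, AddCommGroup (V d)]
  [∀ d, Module K (V d)]

/-- A signed list of words, as an element of the tensor coalgebra. -/
noncomputable def signedSum (L : List (ℤ × List (Σ d : ℤ, V d))) : TCo K V :=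
  (L.map fun p => sgn K p.1 • word p.2).sum

lemma signedSum_append (L M : List (ℤ × List (Σ d : ℤ, V d))) :
    signedSum (K := K) (L ++ M) = signedSum L + signedSum M := by
  simp [signedSum]

lemma signedSum_flatMap_range (n : ℕ) (g : ℕ → List (ℤ × List (Σ d : ℤ, V d))) :
    signedSum (K := K) ((List.range n).flatMap g) =
      ∑ k ∈ Finset.range n, signedSum (g k) := by
  induction n with
  | zero => simp [signedSum]
  | succ n ih =>
    rw [List.range_succ, List.flatMap_append, signedSum_append, ih, Finset.sum_range_succ]
    simp

lemma signedSum_map_cons (L : List (ℤ × List (Σ d : ℤ, V d))) (z : Σ d : ℤ, V d) (n : ℤ) :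
    signedSum (K := K) (L.map fun p => (p.1 + n, z :: p.2)) =
      sgn K n • consMap K V (homog (K := K) z) (signedSum L) := by
  induction L with
  | nil => simp [signedSum]
  | cons p L ih =>
    simp only [signedSum, List.map_cons, List.sum_cons, map_add, smul_add] at ih ⊢
    rw [ih, map_smul, consMap_homog_word, sgn_add, smul_smul, mul_comm]

lemma map_signedSum {M : Type*} [AddCommGroup M] [Module K M] (g : TCo K V →ₗ[K] M)
    (L : List (ℤ × List (Σ d : ℤ, V d))) :
    g (signedSum L) = (L.map fun p => sgn K p.1 • g (word p.2)).sum := by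
  induction L with
  | nil => simp [signedSum]
  | cons p L ih =>
    simp only [signedSum, List.map_cons, List.sum_cons, map_add, map_smul] at ih ⊢
    rw [ih]

end Combos

section Reconstruction

variable {K : Type} [Field K] {V : ℤ → Type} [∀ d, AddCommGroup (V d)]
  [∀ d, Module K (V d)]
  {Δ : TCo K V →ₗ[K] TCo K V ⊗[K] TCo K V} {ε : TCo K V →ₗ[K] K} {p1 : TCo K V →ₗ[K] GrW V}

/-- An element of `T(W) = K ⊕ W ⊗ T(W)` is recovered from its counit and from the
`W ⊗ T(W)`-component of its coproduct. -/
lemma eq_counit_add_cons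
    (hΔ : ∀ l, Δ (word l) =
      ∑ i ∈ Finset.range (l.length + 1), word (l.take i) ⊗ₜ[K] word (l.drop i))
    (hε : ∀ l, ε (word l) = if l.length = 0 then (1 : K) else 0)
    (hp1a : ∀ x, p1 (word [x]) = homog (K := K) x)
    (hp1b : ∀ l, l.length ≠ 1 → p1 (word l) = 0) (t : TCo K V) :
    t = ε t • word [] + TensorProduct.lift ((consMap K V).comp p1) (Δ t) := by
  suffices h : LinearMap.id =
      LinearMap.toSpanSingleton K _ (word []) ∘ₗ ε +
        TensorProduct.lift ((consMap K V).comp p1) ∘ₗ Δ from LinearMap.congr_fun h t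
  refine TCo.linearMap_ext fun l => ?_
  simp only [LinearMap.id_apply, LinearMap.add_apply, LinearMap.comp_apply,
    LinearMap.toSpanSingleton_apply, hε, hΔ, map_sum, TensorProduct.lift.tmul]
  cases l with
  | nil => simp [hp1b []]
  | cons x l =>
    rw [Finset.sum_eq_single 1]
    · simp [hp1a, consMap_homog_word]
    · intro i hi hi1
      rw [hp1b, map_zero, LinearMap.zero_apply]
      simp only [Finset.mem_range, List.length_cons] at hi
      simp only [List.length_take, List.length_cons]
      omega
    · simp

/-- Families satisfying the triple Koszul-signed comultiplicativity relation are determined by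
their counits and degree-one components. -/
lemma eq_of_comul_eq
    (hrec : ∀ t : TCo K V,
      t = ε t • word [] + TensorProduct.lift ((consMap K V).comp p1) (Δ t))
    {g h : List (Σ d : ℤ, V d) → List (Σ d : ℤ, V d) → List (Σ d : ℤ, V d) → TCo K V}
    {s : List (Σ d : ℤ, V d) → List (Σ d : ℤ, V d) → List (Σ d : ℤ, V d) → ℕ → ℕ → ℕ → K}
    (hg : ∀ a b c, Δ (g a b c) = ∑ i ∈ Finset.range (a.length + 1),
      ∑ j ∈ Finset.range (b.length + 1), ∑ k ∈ Finset.range (c.length + 1),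
        s a b c i j k • (g (a.take i) (b.take j) (c.take k) ⊗ₜ[K]
          g (a.drop i) (b.drop j) (c.drop k)))
    (hh : ∀ a b c, Δ (h a b c) = ∑ i ∈ Finset.range (a.length + 1),
      ∑ j ∈ Finset.range (b.length + 1), ∑ k ∈ Finset.range (c.length + 1),
        s a b c i j k • (h (a.take i) (b.take j) (c.take k) ⊗ₜ[K]
          h (a.drop i) (b.drop j) (c.drop k)))
    (hcounit : ∀ a b c, ε (g a b c) = ε (h a b c))
    (hproj : ∀ a b c, p1 (g a b c) = p1 (h a b c))
    (hnil : p1 (g [] [] []) = 0) (a b c : List (Σ d : ℤ, V d)) : g a b c = h a b c := by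
  induction hn : a.length + b.length + c.length using Nat.strong_induction_on
    generalizing a b c with
  | _ n ih =>
    rw [hrec (g a b c), hrec (h a b c), hg, hh, hcounit]
    simp only [map_sum, map_smul, TensorProduct.lift.tmul, LinearMap.comp_apply, ← hproj]
    congr 1
    refine Finset.sum_congr rfl fun i hi => Finset.sum_congr rfl fun j hj =>
      Finset.sum_congr rfl fun k hk => ?_
    simp only [Finset.mem_range] at hi hj hk
    by_cases h0 : i = 0 ∧ j = 0 ∧ k = 0
    · obtain ⟨rfl, rfl, rfl⟩ := h0
      simp [hnil]
    · rw [ih _ _ (a.drop i) (b.drop j) (c.drop k) rfl]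
      simp only [List.length_drop]
      omega

end Reconstruction

section Cup

variable {K : Type} [Field K] {V : ℤ → Type} [∀ d, AddCommGroup (V d)]
  [∀ d, Module K (V d)]
  {Δ : TCo K V →ₗ[K] TCo K V ⊗[K] TCo K V} {ε : TCo K V →ₗ[K] K} {p1 : TCo K V →ₗ[K] GrW V}
  {ΔTT : TCo K V ⊗[K] TCo K V →ₗ[K]
      (TCo K V ⊗[K] TCo K V) ⊗[K] (TCo K V ⊗[K] TCo K V)}
  {br : (Σ d : ℤ, V d) → List (Σ d : ℤ, V d) → (Σ d : ℤ, V d)}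
  {f : TCo K V ⊗[K] TCo K V →ₗ[K] TCo K V}

lemma comul_cup_word
    (hΔTT : ∀ l₁ l₂, ΔTT (word l₁ ⊗ₜ[K] word l₂) =
      ∑ i ∈ Finset.range (l₁.length + 1), ∑ j ∈ Finset.range (l₂.length + 1),
        sgn K (degSum (l₁.drop i) * degSum (l₂.take j)) •
          ((word (l₁.take i) ⊗ₜ[K] word (l₂.take j)) ⊗ₜ[K]
            (word (l₁.drop i) ⊗ₜ[K] word (l₂.drop j))))
    (hf_coalg : Δ ∘ₗ f = (TensorProduct.map f f) ∘ₗ ΔTT) (a b : List (Σ d : ℤ, V d)) :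
    Δ (f (word a ⊗ₜ[K] word b)) =
      ∑ i ∈ Finset.range (a.length + 1), ∑ j ∈ Finset.range (b.length + 1),
        sgn K (degSum (a.drop i) * degSum (b.take j)) •
          (f (word (a.take i) ⊗ₜ[K] word (b.take j)) ⊗ₜ[K]
            f (word (a.drop i) ⊗ₜ[K] word (b.drop j))) := by
  have h := LinearMap.congr_fun hf_coalg (word a ⊗ₜ[K] word b)
  simpa only [LinearMap.comp_apply, hΔTT, map_sum, map_smul, TensorProduct.map_tmul] using h

/-- Splitting off the first letter of a cup product of words. -/
lemma cup_cons_cons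
    (hrec : ∀ t : TCo K V,
      t = ε t • word [] + TensorProduct.lift ((consMap K V).comp p1) (Δ t))
    (hcomul : ∀ a b, Δ (f (word a ⊗ₜ[K] word b)) =
      ∑ i ∈ Finset.range (a.length + 1), ∑ j ∈ Finset.range (b.length + 1),
        sgn K (degSum (a.drop i) * degSum (b.take j)) •
          (f (word (a.take i) ⊗ₜ[K] word (b.take j)) ⊗ₜ[K]
            f (word (a.drop i) ⊗ₜ[K] word (b.drop j))))
    (hcounit : ∀ x xs b, ε (f (word (x :: xs) ⊗ₜ[K] word b)) = 0)
    (hp1a : ∀ x, p1 (word [x]) = homog (K := K) x)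
    (hp1b : ∀ l, l.length ≠ 1 → p1 (word l) = 0)
    (hf_braces : ∀ x l, p1 (f (word [x] ⊗ₜ[K] word l)) = homog (K := K) (br x l))
    (hf_leftinc : ∀ l₁ l₂, 2 ≤ l₁.length → p1 (f (word l₁ ⊗ₜ[K] word l₂)) = 0)
    (hf_unital : ∀ l, f (word [] ⊗ₜ[K] word l) = word l)
    (x y : Σ d : ℤ, V d) (xs ys : List (Σ d : ℤ, V d)) :
    f (word (x :: xs) ⊗ₜ[K] word (y :: ys)) =
      (∑ k ∈ Finset.range (ys.length + 2),
        sgn K (degSum xs * degSum ((y :: ys).take k)) •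
          consMap K V (homog (K := K) (br x ((y :: ys).take k)))
            (f (word xs ⊗ₜ[K] word ((y :: ys).drop k)))) +
      sgn K (degSum (x :: xs) * y.1) •
        consMap K V (homog (K := K) y) (f (word (x :: xs) ⊗ₜ[K] word ys)) := by
  rw [hrec (f (word (x :: xs) ⊗ₜ[K] word (y :: ys))), hcounit, zero_smul, zero_add, hcomul]
  simp only [map_sum, map_smul, TensorProduct.lift.tmul, LinearMap.comp_apply]
  rw [List.length_cons, Finset.sum_range_succ', Finset.sum_range_succ']
  congr 1
  · simp only [List.take_succ_cons, List.take_zero, List.drop_succ_cons, List.drop_zero,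
      hf_braces, List.length_cons]
    refine add_eq_right.2 (Finset.sum_eq_zero fun i hi => Finset.sum_eq_zero fun j _ => ?_)
    rw [hf_leftinc, map_zero, LinearMap.zero_apply, smul_zero]
    simp only [Finset.mem_range] at hi
    simp only [List.length_cons, List.length_take]
    omega
  · rw [Finset.sum_eq_single 1]
    · simp [hf_unital, hp1a, degSum_cons, degSum_nil]
    · intro j hj hj1
      simp only [List.take_zero, hf_unital]
      rw [hp1b, map_zero, LinearMap.zero_apply, smul_zero]
      simp only [Finset.mem_range, List.length_cons] at hj
      simp only [List.length_take, List.length_cons]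
      omega
    · simp

/-- The explicit formula for the cup product of words. -/
lemma signedSum_sigCombos
    (hcons : ∀ x y xs ys, f (word (x :: xs) ⊗ₜ[K] word (y :: ys)) =
      (∑ k ∈ Finset.range (ys.length + 2),
        sgn K (degSum xs * degSum ((y :: ys).take k)) •
          consMap K V (homog (K := K) (br x ((y :: ys).take k)))
            (f (word xs ⊗ₜ[K] word ((y :: ys).drop k)))) +
      sgn K (degSum (x :: xs) * y.1) •
        consMap K V (homog (K := K) y) (f (word (x :: xs) ⊗ₜ[K] word ys)))
    (hbr_unit : ∀ x, br x [] = x)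
    (hf_unital : ∀ l, f (word [] ⊗ₜ[K] word l) = word l ∧
      f (word l ⊗ₜ[K] word []) = word l)
    (xs ys : List (Σ d : ℤ, V d)) (acc : ℤ) :
    signedSum (sigCombos br xs acc ys) =
      sgn K (acc * degSum xs) • f (word xs ⊗ₜ[K] word ys) := by
  induction xs generalizing ys acc with
  | nil => simp [sigCombos, signedSum, degSum_nil, (hf_unital _).1]
  | cons x xs ihx =>
    induction ys generalizing acc with
    | nil =>
      rw [sigCombos_cons_nil, signedSum_map_cons, ihx, hbr_unit, (hf_unital _).2,
        (hf_unital _).2, map_smul, consMap_homog_word, smul_smul, ← sgn_add, degSum_cons]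
      congr 2
      ring
    | cons y ys ihy =>
      have hy := signedSum_map_cons (K := K) (sigCombos br (x :: xs) (acc + y.1) ys) y 0
      simp only [add_zero, sgn_zero, one_smul] at hy
      rw [sigCombos_cons_cons, signedSum_append, signedSum_flatMap_range, hy, ihy, hcons,
        smul_add, Finset.smul_sum, map_smul, smul_smul, ← sgn_add]
      congr 1
      · refine Finset.sum_congr rfl fun k _ => ?_
        rw [signedSum_map_cons, ihx, map_smul, smul_smul, smul_smul, ← sgn_add, ← sgn_add,
          degSum_cons]
        congr 2
        ring
      · congr 2
        ring

lemma koszul_cup_word (hbr_deg : ∀ x l, (br x l).1 = x.1 + degSum l)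
    (hcombos : ∀ a b, f (word a ⊗ₜ[K] word b) = signedSum (sigCombos br a 0 b))
    (m : ℤ) (a b : List (Σ d : ℤ, V d)) :
    koszul K V m (f (word a ⊗ₜ[K] word b)) =
      sgn K (m * (degSum a + degSum b)) • f (word a ⊗ₜ[K] word b) := by
  rw [hcombos, map_signedSum, signedSum, List.smul_sum, List.map_map]
  congr 1
  refine List.map_congr_left fun p hp => ?_
  rw [koszul_word, degSum_of_mem_sigCombos hbr_deg _ _ _ p hp, Function.comp_apply, smul_comm]

lemma comul_tmul_word
    (hΔ : ∀ l, Δ (word l) =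
      ∑ i ∈ Finset.range (l.length + 1), word (l.take i) ⊗ₜ[K] word (l.drop i))
    (hΔTT : ∀ l₁ l₂, ΔTT (word l₁ ⊗ₜ[K] word l₂) =
      ∑ i ∈ Finset.range (l₁.length + 1), ∑ j ∈ Finset.range (l₂.length + 1),
        sgn K (degSum (l₁.drop i) * degSum (l₂.take j)) •
          ((word (l₁.take i) ⊗ₜ[K] word (l₂.take j)) ⊗ₜ[K]
            (word (l₁.drop i) ⊗ₜ[K] word (l₂.drop j))))
    (t : TCo K V) (c : List (Σ d : ℤ, V d)) :
    ΔTT (t ⊗ₜ[K] word c) = ∑ k ∈ Finset.range (c.length + 1),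
      TensorProduct.tensorTensorTensorComm K _ _ _ _
        (TensorProduct.map LinearMap.id (koszul K V (degSum (c.take k))) (Δ t) ⊗ₜ[K]
          (word (c.take k) ⊗ₜ[K] word (c.drop k))) := by
  suffices h : ΔTT ∘ₗ (TensorProduct.mk K (TCo K V) (TCo K V)).flip (word c) =
      ∑ k ∈ Finset.range (c.length + 1),
        (TensorProduct.tensorTensorTensorComm K (TCo K V) (TCo K V) (TCo K V) (TCo K V)).toLinearMap ∘ₗ
          (TensorProduct.mk K (TCo K V ⊗[K] TCo K V) (TCo K V ⊗[K] TCo K V)).flip (word (c.take k) ⊗ₜ[K] word (c.drop k)) ∘ₗ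
          TensorProduct.map (LinearMap.id : TCo K V →ₗ[K] TCo K V)
            (koszul K V (degSum (c.take k))) ∘ₗ Δ by
    simpa using LinearMap.congr_fun h t
  refine TCo.linearMap_ext
    (M := (TCo K V ⊗[K] TCo K V) ⊗[K] (TCo K V ⊗[K] TCo K V)) fun l => ?_
  simp only [LinearMap.comp_apply, LinearMap.flip_apply, TensorProduct.mk_apply, hΔTT,
    LinearMap.sum_apply, hΔ, map_sum, TensorProduct.map_tmul, LinearMap.id_apply, koszul_word,
    TensorProduct.tmul_smul, map_smul, LinearEquiv.coe_coe,
    TensorProduct.tensorTensorTensorComm_tmul]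
  rw [Finset.sum_comm]
  simp only [mul_comm]

lemma comul_word_tmul
    (hΔ : ∀ l, Δ (word l) =
      ∑ i ∈ Finset.range (l.length + 1), word (l.take i) ⊗ₜ[K] word (l.drop i))
    (hΔTT : ∀ l₁ l₂, ΔTT (word l₁ ⊗ₜ[K] word l₂) =
      ∑ i ∈ Finset.range (l₁.length + 1), ∑ j ∈ Finset.range (l₂.length + 1),
        sgn K (degSum (l₁.drop i) * degSum (l₂.take j)) •
          ((word (l₁.take i) ⊗ₜ[K] word (l₂.take j)) ⊗ₜ[K]
            (word (l₁.drop i) ⊗ₜ[K] word (l₂.drop j))))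
    (a : List (Σ d : ℤ, V d)) (t : TCo K V) :
    ΔTT (word a ⊗ₜ[K] t) = ∑ i ∈ Finset.range (a.length + 1),
      TensorProduct.tensorTensorTensorComm K _ _ _ _
        ((word (a.take i) ⊗ₜ[K] word (a.drop i)) ⊗ₜ[K]
          TensorProduct.map (koszul K V (degSum (a.drop i))) LinearMap.id (Δ t)) := by
  suffices h : ΔTT ∘ₗ TensorProduct.mk K (TCo K V) (TCo K V) (word a) =
      ∑ i ∈ Finset.range (a.length + 1),
        (TensorProduct.tensorTensorTensorComm K (TCo K V) (TCo K V) (TCo K V) (TCo K V)).toLinearMap ∘ₗ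
          TensorProduct.mk K (TCo K V ⊗[K] TCo K V) (TCo K V ⊗[K] TCo K V) (word (a.take i) ⊗ₜ[K] word (a.drop i)) ∘ₗ
          TensorProduct.map (koszul K V (degSum (a.drop i)))
            (LinearMap.id : TCo K V →ₗ[K] TCo K V) ∘ₗ Δ by
    simpa using LinearMap.congr_fun h t
  refine TCo.linearMap_ext
    (M := (TCo K V ⊗[K] TCo K V) ⊗[K] (TCo K V ⊗[K] TCo K V)) fun l => ?_
  simp only [LinearMap.comp_apply, TensorProduct.mk_apply, hΔTT,
    LinearMap.sum_apply, hΔ, map_sum, TensorProduct.map_tmul, LinearMap.id_apply, koszul_word,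
    map_smul, ← TensorProduct.smul_tmul',
    LinearEquiv.coe_coe, TensorProduct.tensorTensorTensorComm_tmul]

lemma comul_cup_cup_left
    (hΔ : ∀ l, Δ (word l) =
      ∑ i ∈ Finset.range (l.length + 1), word (l.take i) ⊗ₜ[K] word (l.drop i))
    (hΔTT : ∀ l₁ l₂, ΔTT (word l₁ ⊗ₜ[K] word l₂) =
      ∑ i ∈ Finset.range (l₁.length + 1), ∑ j ∈ Finset.range (l₂.length + 1),
        sgn K (degSum (l₁.drop i) * degSum (l₂.take j)) •
          ((word (l₁.take i) ⊗ₜ[K] word (l₂.take j)) ⊗ₜ[K]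
            (word (l₁.drop i) ⊗ₜ[K] word (l₂.drop j))))
    (hf_coalg : Δ ∘ₗ f = (TensorProduct.map f f) ∘ₗ ΔTT)
    (hkoszul : ∀ m a b, koszul K V m (f (word a ⊗ₜ[K] word b)) =
      sgn K (m * (degSum a + degSum b)) • f (word a ⊗ₜ[K] word b))
    (a b c : List (Σ d : ℤ, V d)) :
    Δ (f (f (word a ⊗ₜ[K] word b) ⊗ₜ[K] word c)) =
      ∑ i ∈ Finset.range (a.length + 1), ∑ j ∈ Finset.range (b.length + 1),
        ∑ k ∈ Finset.range (c.length + 1),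
          sgn K (degSum (a.drop i) * degSum (b.take j) + degSum (a.drop i) * degSum (c.take k) +
              degSum (b.drop j) * degSum (c.take k)) •
            (f (f (word (a.take i) ⊗ₜ[K] word (b.take j)) ⊗ₜ[K] word (c.take k)) ⊗ₜ[K]
              f (f (word (a.drop i) ⊗ₜ[K] word (b.drop j)) ⊗ₜ[K] word (c.drop k))) := by
  have h := LinearMap.congr_fun hf_coalg (f (word a ⊗ₜ[K] word b) ⊗ₜ[K] word c)
  simp only [LinearMap.comp_apply, comul_tmul_word hΔ hΔTT,
    comul_cup_word hΔTT hf_coalg, map_sum, map_smul, TensorProduct.map_tmul, LinearMap.id_apply,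
    hkoszul, TensorProduct.tmul_smul, TensorProduct.sum_tmul, ← TensorProduct.smul_tmul',
    TensorProduct.tensorTensorTensorComm_tmul, smul_smul, ← sgn_add] at h
  rw [h, Finset.sum_comm]
  refine Finset.sum_congr rfl fun i _ => ?_
  rw [Finset.sum_comm]
  refine Finset.sum_congr rfl fun j _ => Finset.sum_congr rfl fun k _ => ?_
  congr 2
  ring

lemma comul_cup_cup_right
    (hΔ : ∀ l, Δ (word l) =
      ∑ i ∈ Finset.range (l.length + 1), word (l.take i) ⊗ₜ[K] word (l.drop i))
    (hΔTT : ∀ l₁ l₂, ΔTT (word l₁ ⊗ₜ[K] word l₂) =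
      ∑ i ∈ Finset.range (l₁.length + 1), ∑ j ∈ Finset.range (l₂.length + 1),
        sgn K (degSum (l₁.drop i) * degSum (l₂.take j)) •
          ((word (l₁.take i) ⊗ₜ[K] word (l₂.take j)) ⊗ₜ[K]
            (word (l₁.drop i) ⊗ₜ[K] word (l₂.drop j))))
    (hf_coalg : Δ ∘ₗ f = (TensorProduct.map f f) ∘ₗ ΔTT)
    (hkoszul : ∀ m a b, koszul K V m (f (word a ⊗ₜ[K] word b)) =
      sgn K (m * (degSum a + degSum b)) • f (word a ⊗ₜ[K] word b))
    (a b c : List (Σ d : ℤ, V d)) :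
    Δ (f (word a ⊗ₜ[K] f (word b ⊗ₜ[K] word c))) =
      ∑ i ∈ Finset.range (a.length + 1), ∑ j ∈ Finset.range (b.length + 1),
        ∑ k ∈ Finset.range (c.length + 1),
          sgn K (degSum (a.drop i) * degSum (b.take j) + degSum (a.drop i) * degSum (c.take k) +
              degSum (b.drop j) * degSum (c.take k)) •
            (f (word (a.take i) ⊗ₜ[K] f (word (b.take j) ⊗ₜ[K] word (c.take k))) ⊗ₜ[K]
              f (word (a.drop i) ⊗ₜ[K] f (word (b.drop j) ⊗ₜ[K] word (c.drop k)))) := by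
  have h := LinearMap.congr_fun hf_coalg (word a ⊗ₜ[K] f (word b ⊗ₜ[K] word c))
  simp only [LinearMap.comp_apply, comul_word_tmul hΔ hΔTT,
    comul_cup_word hΔTT hf_coalg, map_sum, map_smul, TensorProduct.map_tmul, LinearMap.id_apply,
    hkoszul, TensorProduct.tmul_smul, TensorProduct.tmul_sum, ← TensorProduct.smul_tmul',
    TensorProduct.tensorTensorTensorComm_tmul, smul_smul, ← sgn_add] at h
  rw [h]
  refine Finset.sum_congr rfl fun i _ => Finset.sum_congr rfl fun j _ =>
    Finset.sum_congr rfl fun k _ => ?_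
  congr 2
  ring

/-- The degree-one part of `t ∪ c` depends only on the components of `t` of length at most one. -/
lemma proj_cup_tmul_word
    (hε : ∀ l, ε (word l) = if l.length = 0 then (1 : K) else 0)
    (hp1a : ∀ x, p1 (word [x]) = homog (K := K) x)
    (hp1b : ∀ l, l.length ≠ 1 → p1 (word l) = 0)
    (hf_leftinc : ∀ l₁ l₂, 2 ≤ l₁.length → p1 (f (word l₁ ⊗ₜ[K] word l₂)) = 0)
    (hf_unital : ∀ l, f (word [] ⊗ₜ[K] word l) = word l)
    (t : TCo K V) (c : List (Σ d : ℤ, V d)) :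
    p1 (f (t ⊗ₜ[K] word c)) =
      ε t • p1 (word c) + p1 (f (consMap K V (p1 t) (word []) ⊗ₜ[K] word c)) := by
  suffices h : p1 ∘ₗ f ∘ₗ (TensorProduct.mk K _ _).flip (word c) =
      LinearMap.toSpanSingleton K _ (p1 (word c)) ∘ₗ ε +
        p1 ∘ₗ f ∘ₗ (TensorProduct.mk K _ _).flip (word c) ∘ₗ (consMap K V).flip (word []) ∘ₗ p1 by
    simpa using LinearMap.congr_fun h t
  refine TCo.linearMap_ext fun l => ?_
  simp only [LinearMap.comp_apply, LinearMap.add_apply, LinearMap.flip_apply,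
    TensorProduct.mk_apply, LinearMap.toSpanSingleton_apply, hε]
  match l with
  | [] => simp [hf_unital, hp1b []]
  | [x] => simp [hp1a, consMap_homog_word]
  | x :: y :: l => simp [hf_leftinc (x :: y :: l) c (by simp), hp1b (x :: y :: l) (by simp)]

end Cup

/-!
Statement 4.  The coalgebra map `∪` on `T(V[1])` extending a brace structure
(formula (3) of the paper; here characterized as the counital coalgebra
morphism whose degree-one component is given by the braces, vanishing on
left factors of length ≥ 2) is associative iff the braces satisfy the
higher pre-Jacobi identities.
-/

theorem brace_cup_associative_iff_preJacobi
    {K : Type} [Field K] {V : ℤ → Type} [∀ d, AddCommGroup (V d)]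
    [∀ d, Module K (V d)]
    -- deconcatenation coproduct, counit, degree-one projection of `T(V[1])`
    (Δ : TCo K V →ₗ[K] TCo K V ⊗[K] TCo K V)
    (hΔ : ∀ l, Δ (word l) =
      ∑ i ∈ Finset.range (l.length + 1), word (l.take i) ⊗ₜ[K] word (l.drop i))
    (ε : TCo K V →ₗ[K] K)
    (hε : ∀ l, ε (word l) = if l.length = 0 then (1 : K) else 0)
    (p1 : TCo K V →ₗ[K] GrW V)
    (hp1a : ∀ x, p1 (word [x]) = homog (K := K) x)
    (hp1b : ∀ l, l.length ≠ 1 → p1 (word l) = 0)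
    (ΔTT : TCo K V ⊗[K] TCo K V →ₗ[K]
      (TCo K V ⊗[K] TCo K V) ⊗[K] (TCo K V ⊗[K] TCo K V))
    (hΔTT : ∀ l₁ l₂, ΔTT (word l₁ ⊗ₜ[K] word l₂) =
      ∑ i ∈ Finset.range (l₁.length + 1), ∑ j ∈ Finset.range (l₂.length + 1),
        ((Int.negOnePow (degSum (l₁.drop i) * degSum (l₂.take j)) : ℤˣ) : ℤ) •
          ((word (l₁.take i) ⊗ₜ[K] word (l₂.take j)) ⊗ₜ[K]
            (word (l₁.drop i) ⊗ₜ[K] word (l₂.drop j))))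
    (εTT : TCo K V ⊗[K] TCo K V →ₗ[K] K)
    (hεTT : ∀ l₁ l₂, εTT (word l₁ ⊗ₜ[K] word l₂) =
      (if l₁.length = 0 then (1 : K) else 0) * (if l₂.length = 0 then (1 : K) else 0))
    -- the brace structure: degree-zero operations with `x{} = x`
    (br : (Σ d : ℤ, V d) → List (Σ d : ℤ, V d) → (Σ d : ℤ, V d))
    (hbr_unit : ∀ x, br x [] = x)
    (hbr_deg : ∀ x l, (br x l).1 = x.1 + degSum l)
    -- `f = ∪` is the counital coalgebra morphism extending the braces
    (f : TCo K V ⊗[K] TCo K V →ₗ[K] TCo K V)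
    (hf_counit : ε ∘ₗ f = εTT)
    (hf_coalg : Δ ∘ₗ f = (TensorProduct.map f f) ∘ₗ ΔTT)
    (hf_braces : ∀ x l, p1 (f (word [x] ⊗ₜ[K] word l)) = homog (K := K) (br x l))
    (hf_leftinc : ∀ l₁ l₂, 2 ≤ l₁.length → p1 (f (word l₁ ⊗ₜ[K] word l₂)) = 0)
    (hf_unital : ∀ l, f (word [] ⊗ₜ[K] word l) = word l ∧
      f (word l ⊗ₜ[K] word []) = word l) :
    -- `∪` associative  ↔  higher pre-Jacobi identities
    (f ∘ₗ TensorProduct.map f LinearMap.id =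
      (f ∘ₗ TensorProduct.map LinearMap.id f) ∘ₗ
        (TensorProduct.assoc K (TCo K V) (TCo K V) (TCo K V) :
          (TCo K V ⊗[K] TCo K V) ⊗[K] TCo K V →ₗ[K]
            TCo K V ⊗[K] (TCo K V ⊗[K] TCo K V))) ↔
    SigmaPreJacobi (K := K) br := by
  have hΔTT' : ∀ l₁ l₂, ΔTT (word l₁ ⊗ₜ[K] word l₂) =
      ∑ i ∈ Finset.range (l₁.length + 1), ∑ j ∈ Finset.range (l₂.length + 1),
        sgn K (degSum (l₁.drop i) * degSum (l₂.take j)) •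
          ((word (l₁.take i) ⊗ₜ[K] word (l₂.take j)) ⊗ₜ[K]
            (word (l₁.drop i) ⊗ₜ[K] word (l₂.drop j))) := by
    simpa only [sgn_smul (K := K)] using hΔTT
  have hunit_left := fun l => (hf_unital l).1
  have hrec := eq_counit_add_cons hΔ hε hp1a hp1b
  have hcounit_cup : ∀ t u, ε (f (t ⊗ₜ[K] u)) = ε t * ε u := by
    have h : ε ∘ₗ f = LinearMap.mul' K K ∘ₗ TensorProduct.map ε ε := by
      rw [hf_counit]
      refine TensorProduct.ext (TCo.linearMap_ext fun a => TCo.linearMap_ext fun b => ?_)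
      simp [hεTT, hε]
    intro t u
    simpa using LinearMap.congr_fun h (t ⊗ₜ[K] u)
  have hcombos : ∀ a b, f (word a ⊗ₜ[K] word b) = signedSum (sigCombos br a 0 b) := by
    intro a b
    rw [signedSum_sigCombos (cup_cons_cons hrec (comul_cup_word hΔTT' hf_coalg)
      (fun x xs b => by simp [hcounit_cup, hε]) hp1a hp1b hf_braces hf_leftinc hunit_left)
      hbr_unit hf_unital, zero_mul, sgn_zero, one_smul]
  have hkoszul := koszul_cup_word hbr_deg hcombos
  have hproj_left : ∀ x b c, p1 (f (f (word [x] ⊗ₜ[K] word b) ⊗ₜ[K] word c)) =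
      homog (K := K) (br (br x b) c) := by
    intro x b c
    rw [proj_cup_tmul_word hε hp1a hp1b hf_leftinc hunit_left, hcounit_cup, hf_braces,
      consMap_homog_word, hf_braces]
    simp [hε]
  have hproj_right : ∀ x b c, p1 (f (word [x] ⊗ₜ[K] f (word b ⊗ₜ[K] word c))) =
      ((sigCombos br b 0 c).map
        fun p => ((Int.negOnePow p.1 : ℤˣ) : ℤ) • homog (K := K) (br x p.2)).sum := by
    intro x b c
    have h := map_signedSum (p1 ∘ₗ f ∘ₗ TensorProduct.mk K _ _ (word [x])) (sigCombos br b 0 c)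
    simpa only [← hcombos, LinearMap.comp_apply, TensorProduct.mk_apply, hf_braces,
      ← sgn_smul (K := K)] using h
  constructor
  · intro hassoc x xs ys
    have h := LinearMap.congr_fun hassoc ((word [x] ⊗ₜ[K] word xs) ⊗ₜ[K] word ys)
    simp only [LinearMap.comp_apply, LinearEquiv.coe_coe, TensorProduct.map_tmul,
      TensorProduct.assoc_tmul, LinearMap.id_apply] at h
    rw [← hproj_left, ← hproj_right, h]
  · intro hJ
    have key : ∀ a b c, f (f (word a ⊗ₜ[K] word b) ⊗ₜ[K] word c) =
        f (word a ⊗ₜ[K] f (word b ⊗ₜ[K] word c)) := by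
      refine eq_of_comul_eq
        (g := fun a b c => f (f (word a ⊗ₜ[K] word b) ⊗ₜ[K] word c))
        (h := fun a b c => f (word a ⊗ₜ[K] f (word b ⊗ₜ[K] word c))) hrec
        (comul_cup_cup_left hΔ hΔTT' hf_coalg hkoszul)
        (comul_cup_cup_right hΔ hΔTT' hf_coalg hkoszul) ?_ ?_ ?_
      · intro a b c
        simp only [hcounit_cup, mul_assoc]
      · intro a b c
        match a with
        | [] =>
          have h : f ∘ₗ TensorProduct.mk K _ _ (word []) = LinearMap.id :=
            TCo.linearMap_ext hunit_left
          rw [hunit_left]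
          exact congrArg p1 (LinearMap.congr_fun h _).symm
        | [x] => rw [hproj_left, hproj_right, hJ]
        | x :: y :: a =>
          have h := map_signedSum (p1 ∘ₗ f ∘ₗ TensorProduct.mk K _ _ (word (x :: y :: a)))
            (sigCombos br b 0 c)
          simp only [← hcombos, LinearMap.comp_apply, TensorProduct.mk_apply,
            hf_leftinc (x :: y :: a) _ (by simp)] at h
          rw [h, proj_cup_tmul_word hε hp1a hp1b hf_leftinc hunit_left, hcounit_cup,
            hf_leftinc _ _ (by simp)]
          simp [hε]
      · simp [hunit_left, hp1b []]
    refine TensorProduct.ext (TensorProduct.ext (TCo.linearMap_ext fun a =>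
      TCo.linearMap_ext fun b => TCo.linearMap_ext fun c => ?_))
    exact key a b c
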